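/- Let (ϑₙ)_{n∈ℕ} be a submartingale (with respect to its natural filtration) with values in [0,1], so that there exists a random variable ϑ_∞ with values in [0,1] such that ϑₙ → ϑ_∞ almost surely. Let S = {0,1} and for each n let ξₙ be the random probability measure on S with ξₙ({1}) = ϑₙ and ξₙ({0}) = 1 − ϑₙ. If ξ = (ξ₀, ξ₁, …) is a product disintegration of a sequence X = (X₀, X₁, …) of S-valued random variables, then with probability one limₙ→∞ (1/n) ∑_{i=0}^{n-1} 𝟙{Xᵢ = 1} = ϑ_∞. -/

import Mathlib

open MeasureTheory ProbabilityTheory Filter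

noncomputable section

/-- The σ-algebra generated by a sequence of random (probability) measures. -/
def sigmaGen {Ω S : Type*} [MeasurableSpace S] (ξ : ℕ → Ω → Measure S) :
    MeasurableSpace Ω :=
  ⨆ n, MeasurableSpace.comap (ξ n) inferInstance

/-- `ξ` is a product disintegration of `X`: each `ξ n` is a random probability measure on `S`,
each `X n` is a random variable, and for every `n` and Borel sets `A 0, …, A n`, almost surely
`𝔼[𝟙{X₀∈A₀} ⋯ 𝟙{Xₙ∈Aₙ} | σ(ξ)] = ξ₀(A₀) ⋯ ξₙ(Aₙ)`. -/
def IsProductDisintegration {Ω S : Type*} [MeasurableSpace Ω] [MeasurableSpace S]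
    (P : Measure Ω) (X : ℕ → Ω → S) (ξ : ℕ → Ω → Measure S) : Prop :=
  (∀ n, Measurable (X n)) ∧ (∀ n, Measurable (ξ n)) ∧
    (∀ n ω, IsProbabilityMeasure (ξ n ω)) ∧
    ∀ (n : ℕ) (A : Fin (n + 1) → Set S), (∀ i, MeasurableSet (A i)) →
      (P[(fun ω => ∏ i : Fin (n + 1), (A i).indicator (fun _ => (1 : ℝ)) (X i ω)) | sigmaGen ξ])
        =ᵐ[P] fun ω => ∏ i : Fin (n + 1), (ξ i ω (A i)).toReal

/-- Along the squares, the averages of a bounded orthogonal sequence tend to `0` almost surely. -/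
theorem ae_tendsto_sum_div_sq_of_orthogonal {Ω : Type*} [MeasurableSpace Ω] {P : Measure Ω}
    [IsProbabilityMeasure P] {D : ℕ → Ω → ℝ} (hD : ∀ i, Measurable (D i))
    (hbdd : ∀ i ω, |D i ω| ≤ 1) (horth : ∀ i j, i ≠ j → ∫ ω, D i ω * D j ω ∂P = 0) :
    ∀ᵐ ω ∂P, Tendsto (fun k : ℕ => (∑ i ∈ Finset.range ((k + 1) ^ 2), D i ω) /
      (((k + 1) ^ 2 : ℕ) : ℝ)) atTop (nhds 0) := by
  have hprod_bdd : ∀ i j ω, |D i ω * D j ω| ≤ 1 := fun i j ω => by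
    rw [abs_mul]
    exact mul_le_one₀ (hbdd i ω) (abs_nonneg _) (hbdd j ω)
  have hint : ∀ i j, Integrable (fun ω => D i ω * D j ω) P := fun i j =>
    Integrable.of_bound ((hD i).mul (hD j)).aestronglyMeasurable 1
      (ae_of_all _ (hprod_bdd i j))
  have hsq : ∀ N, (fun ω => (∑ i ∈ Finset.range N, D i ω) ^ 2) =
      fun ω => ∑ i ∈ Finset.range N, ∑ j ∈ Finset.range N, D i ω * D j ω := fun N => by
    funext ω
    rw [sq, Finset.sum_mul_sum]
  have hsq_int : ∀ N, Integrable (fun ω => (∑ i ∈ Finset.range N, D i ω) ^ 2) P := fun N => by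
    rw [hsq]
    exact integrable_finsetSum _ fun i _ => integrable_finsetSum _ fun j _ => hint i j
  have hvar : ∀ N : ℕ, ∫ ω, (∑ i ∈ Finset.range N, D i ω) ^ 2 ∂P ≤ N := fun N => by
    rw [hsq, integral_finsetSum _ fun i _ => integrable_finsetSum _ fun j _ => hint i j]
    calc ∑ i ∈ Finset.range N, ∫ ω, ∑ j ∈ Finset.range N, D i ω * D j ω ∂P
        ≤ ∑ i ∈ Finset.range N, (1 : ℝ) := by
          refine Finset.sum_le_sum fun i hi => ?_
          rw [integral_finsetSum _ fun j _ => hint i j,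
            Finset.sum_eq_single_of_mem i hi fun j _ hji => horth i j hji.symm]
          calc ∫ ω, D i ω * D i ω ∂P ≤ ∫ _, (1 : ℝ) ∂P :=
                integral_mono (hint i i) (integrable_const _)
                  fun ω => (le_abs_self _).trans (hprod_bdd i i ω)
            _ = 1 := by simp
      _ = N := by simp
  let Y : ℕ → Ω → ℝ := fun k ω =>
    ((∑ i ∈ Finset.range ((k + 1) ^ 2), D i ω) / (((k + 1) ^ 2 : ℕ) : ℝ)) ^ 2
  have hYint : ∀ k, Integrable (Y k) P := fun k => by
    simp only [Y, div_pow]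
    exact (hsq_int _).div_const _
  have hYmeas : ∀ k, Measurable (Y k) := fun k =>
    ((Finset.measurable_fun_sum _ fun i _ => hD i).div_const _).pow_const 2
  have hYle : ∀ k, ∫ ω, Y k ω ∂P ≤ 1 / ((k + 1 : ℕ) : ℝ) ^ 2 := fun k => by
    simp only [Y, div_pow]
    rw [integral_div, div_le_div_iff₀ (by positivity) (by positivity)]
    calc _ ≤ (((k + 1) ^ 2 : ℕ) : ℝ) * ((k + 1 : ℕ) : ℝ) ^ 2 := by
          gcongr
          exact hvar _
      _ = _ := by push_cast; ring
  have hsum : ∫⁻ ω, ∑' k, ENNReal.ofReal (Y k ω) ∂P ≠ ⊤ := by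
    rw [lintegral_tsum fun k => (hYmeas k).ennreal_ofReal.aemeasurable]
    have hs : Summable fun k : ℕ => 1 / ((k + 1 : ℕ) : ℝ) ^ 2 :=
      (summable_nat_add_iff 1).2 (Real.summable_one_div_nat_pow.2 one_lt_two)
    refine ne_top_of_le_ne_top hs.tsum_ofReal_ne_top (ENNReal.tsum_le_tsum fun k => ?_)
    rw [← ofReal_integral_eq_lintegral_ofReal (hYint k) (ae_of_all _ fun ω => sq_nonneg _)]
    exact ENNReal.ofReal_le_ofReal (hYle k)
  filter_upwards [ae_lt_top (Measurable.tsum fun k => (hYmeas k).ennreal_ofReal) hsum]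
    with ω hω
  have hY : Tendsto (fun k => Y k ω) atTop (nhds 0) := by
    have h := (ENNReal.tendsto_toReal ENNReal.zero_ne_top).comp
      (ENNReal.tendsto_atTop_zero_of_tsum_ne_top hω.ne)
    simpa [Function.comp_def, Y, ENNReal.toReal_ofReal, sq_nonneg] using h
  have h := hY.sqrt
  simp only [Y, Real.sqrt_sq_eq_abs, Real.sqrt_zero] at h
  exact (tendsto_zero_iff_abs_tendsto_zero _).2 h

/-- If a nondecreasing sequence satisfies `u n / n → l` along the squares, then `u n / n → l`. -/
theorem tendsto_div_of_monotone_of_tendsto_sq {u : ℕ → ℝ} {l : ℝ} (hu : Monotone u)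
    (h : Tendsto (fun k : ℕ => u ((k + 1) ^ 2) / (((k + 1) ^ 2 : ℕ) : ℝ)) atTop (nhds l)) :
    Tendsto (fun n : ℕ => u n / n) atTop (nhds l) := by
  refine tendsto_div_of_monotone_of_exists_subseq_tendsto_div u l hu fun a ha =>
    ⟨fun k => (k + 1) ^ 2, ?_, ?_, h⟩
  · have hlim : Tendsto (fun k : ℕ => (1 + 1 / ((k : ℝ) + 1)) ^ 2) atTop (nhds 1) := by
      simpa using (tendsto_one_div_add_atTop_nhds_zero_nat (𝕜 := ℝ)).const_add 1 |>.pow 2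
    filter_upwards [hlim.eventually_le_const ha] with k hk
    have hk0 : (0 : ℝ) < k + 1 := by positivity
    calc (((k + 1 + 1) ^ 2 : ℕ) : ℝ) = (1 + 1 / ((k : ℝ) + 1)) ^ 2 * ((k : ℝ) + 1) ^ 2 := by
          push_cast
          field_simp
      _ ≤ a * (((k + 1) ^ 2 : ℕ) : ℝ) := by
          push_cast
          gcongr
  · exact (tendsto_pow_atTop two_ne_zero).comp (tendsto_add_atTop_nat 1)

theorem sigmaGen_le {Ω S : Type*} [MeasurableSpace Ω] [MeasurableSpace S]
    {ξ : ℕ → Ω → Measure S} (hξ : ∀ n, Measurable (ξ n)) :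
    sigmaGen ξ ≤ (inferInstance : MeasurableSpace Ω) :=
  iSup_le fun n => (hξ n).comap_le

theorem measurable_sigmaGen_apply {Ω S : Type*} [MeasurableSpace S] (ξ : ℕ → Ω → Measure S)
    (n : ℕ) {s : Set S} (hs : MeasurableSet s) :
    Measurable[sigmaGen ξ] fun ω => (ξ n ω s).toReal := by
  have h : Measurable[sigmaGen ξ] (ξ n) :=
    (comap_measurable (ξ n)).mono (le_iSup (fun n => MeasurableSpace.comap (ξ n) inferInstance) n)
      le_rfl
  exact ((Measure.measurable_coe hs).comp h).ennreal_toReal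

namespace IsProductDisintegration

variable {Ω S : Type*} [MeasurableSpace Ω] [MeasurableSpace S] {P : Measure Ω}
  {X : ℕ → Ω → S} {ξ : ℕ → Ω → Measure S}

/-- The product formula restricted to a finite set of coordinates. -/
theorem condExp_prod_finset (h : IsProductDisintegration P X ξ) (T : Finset ℕ) {s : Set S}
    (hs : MeasurableSet s) :
    P[(fun ω => ∏ k ∈ T, s.indicator (fun _ => (1 : ℝ)) (X k ω)) | sigmaGen ξ]
      =ᵐ[P] fun ω => ∏ k ∈ T, (ξ k ω s).toReal := by
  classical
  obtain ⟨-, -, hprob, hcond⟩ := h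
  have hT : Finset.range (T.sup id + 1) ∩ T = T :=
    Finset.inter_eq_right.2 fun k hk =>
      Finset.mem_range.2 (Nat.lt_succ_of_le (Finset.le_sup (f := id) hk))
  have hfin : ∀ f : ℕ → ℝ,
      ∏ i : Fin (T.sup id + 1), (if (i : ℕ) ∈ T then f i else 1) = ∏ k ∈ T, f k := fun f => by
    rw [Fin.prod_univ_eq_prod_range (fun k => if k ∈ T then f k else 1), Finset.prod_ite_mem, hT]
  have key := hcond (T.sup id) (fun i => if (i : ℕ) ∈ T then s else Set.univ) fun i => by
    split_ifs
    exacts [hs, MeasurableSet.univ]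
  have hl : ∀ (i : ℕ) (ω : Ω),
      (if i ∈ T then s else Set.univ).indicator (fun _ => (1 : ℝ)) (X i ω) =
        if i ∈ T then s.indicator (fun _ => (1 : ℝ)) (X i ω) else 1 := fun i ω => by
    split_ifs <;> simp
  have hr : ∀ (i : ℕ) (ω : Ω), (ξ i ω (if i ∈ T then s else Set.univ)).toReal =
      if i ∈ T then (ξ i ω s).toReal else 1 := fun i ω => by
    have := hprob i ω
    split_ifs <;> simp
  simp only [hl, hr] at key
  have e : ∀ ω, ∏ i : Fin (T.sup id + 1),
      (if (i : ℕ) ∈ T then s.indicator (fun _ => (1 : ℝ)) (X i ω) else 1) =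
        ∏ k ∈ T, s.indicator (fun _ => (1 : ℝ)) (X k ω) := fun ω =>
    hfin fun k => s.indicator (fun _ => (1 : ℝ)) (X k ω)
  have e' : ∀ ω, ∏ i : Fin (T.sup id + 1), (if (i : ℕ) ∈ T then (ξ i ω s).toReal else 1) =
      ∏ k ∈ T, (ξ k ω s).toReal := fun ω => hfin fun k => (ξ k ω s).toReal
  simpa only [e, e'] using key

theorem measurable_indicator (h : IsProductDisintegration P X ξ) {s : Set S}
    (hs : MeasurableSet s) (i : ℕ) :
    Measurable fun ω => s.indicator (fun _ => (1 : ℝ)) (X i ω) :=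
  (measurable_const.indicator hs).comp (h.1 i)

theorem measurable_toReal (h : IsProductDisintegration P X ξ) {s : Set S}
    (hs : MeasurableSet s) (i : ℕ) : Measurable fun ω => (ξ i ω s).toReal :=
  (measurable_sigmaGen_apply ξ i hs).mono (sigmaGen_le h.2.1) le_rfl

theorem toReal_le_one (h : IsProductDisintegration P X ξ) (s : Set S) (i : ℕ) (ω : Ω) :
    (ξ i ω s).toReal ≤ 1 :=
  have := h.2.2.1 i ω
  ENNReal.toReal_le_of_le_ofReal zero_le_one (by simpa using prob_le_one)

theorem abs_indicator_sub_le_one (h : IsProductDisintegration P X ξ) (s : Set S) (i : ℕ) (ω : Ω) :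
    |s.indicator (fun _ => (1 : ℝ)) (X i ω) - (ξ i ω s).toReal| ≤ 1 := by
  have h1 := h.toReal_le_one s i ω
  have h0 : 0 ≤ (ξ i ω s).toReal := ENNReal.toReal_nonneg
  by_cases hx : X i ω ∈ s
  · rw [Set.indicator_of_mem hx, abs_le]
    constructor <;> linarith
  · rw [Set.indicator_of_notMem hx, abs_le]
    constructor <;> linarith

/-- Distinct centred indicators are orthogonal. -/
theorem integral_centred_mul_centred [IsProbabilityMeasure P] (h : IsProductDisintegration P X ξ)
    {s : Set S} (hs : MeasurableSet s) {i j : ℕ} (hij : i ≠ j) :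
    ∫ ω, (s.indicator (fun _ => (1 : ℝ)) (X i ω) - (ξ i ω s).toReal) *
      (s.indicator (fun _ => (1 : ℝ)) (X j ω) - (ξ j ω s).toReal) ∂P = 0 := by
  have hm := sigmaGen_le h.2.1
  let I : ℕ → Ω → ℝ := fun k ω => s.indicator (fun _ => (1 : ℝ)) (X k ω)
  let p : ℕ → Ω → ℝ := fun k ω => (ξ k ω s).toReal
  have hI : ∀ k, Measurable (I k) := h.measurable_indicator hs
  have hp : ∀ k, Measurable (p k) := h.measurable_toReal hs
  have hIb : ∀ k ω, ‖I k ω‖ ≤ 1 := fun k ω => by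
    by_cases hx : X k ω ∈ s <;> simp [I, hx]
  have hpb : ∀ k ω, ‖p k ω‖ ≤ 1 := fun k ω => by
    rw [Real.norm_of_nonneg ENNReal.toReal_nonneg]
    exact h.toReal_le_one s k ω
  have hint : ∀ {f g : Ω → ℝ}, Measurable f → Measurable g → (∀ ω, ‖f ω‖ ≤ 1) →
      (∀ ω, ‖g ω‖ ≤ 1) → Integrable (fun ω => f ω * g ω) P := fun hf hg hfb hgb =>
    Integrable.of_bound (hf.mul hg).aestronglyMeasurable 1 (ae_of_all _ fun ω => by
      rw [norm_mul]
      exact mul_le_one₀ (hfb ω) (norm_nonneg _) (hgb ω))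
  have hII : ∫ ω, I i ω * I j ω ∂P = ∫ ω, p i ω * p j ω ∂P := by
    have key := h.condExp_prod_finset {i, j} hs
    simp only [Finset.prod_pair hij] at key
    rw [← integral_condExp hm]
    exact integral_congr_ae key
  have hIp : ∀ k l, ∫ ω, I k ω * p l ω ∂P = ∫ ω, p k ω * p l ω ∂P := fun k l => by
    have key := h.condExp_prod_finset {k} hs
    simp only [Finset.prod_singleton] at key
    have hIint : Integrable (I k) P :=
      Integrable.of_bound (hI k).aestronglyMeasurable 1 (ae_of_all _ (hIb k))
    have hpull := condExp_mul_of_stronglyMeasurable_right (m := sigmaGen ξ) (μ := P)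
      (measurable_sigmaGen_apply ξ l hs).stronglyMeasurable
      (hint (hI k) (hp l) (hIb k) (hpb l)) hIint
    rw [← integral_condExp hm]
    refine integral_congr_ae (hpull.trans ?_)
    filter_upwards [key] with ω hω
    exact congrArg (· * p l ω) hω
  have hexp : ∀ ω, (I i ω - p i ω) * (I j ω - p j ω) =
      I i ω * I j ω - I i ω * p j ω - (I j ω * p i ω - p i ω * p j ω) := fun ω => by ring
  have i1 := hint (hI i) (hI j) (hIb i) (hIb j)
  have i2 := hint (hI i) (hp j) (hIb i) (hpb j)
  have i3 := hint (hI j) (hp i) (hIb j) (hpb i)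
  have i4 := hint (hp i) (hp j) (hpb i) (hpb j)
  change ∫ ω, (I i ω - p i ω) * (I j ω - p j ω) ∂P = 0
  simp only [hexp]
  have hcomm : ∫ ω, p j ω * p i ω ∂P = ∫ ω, p i ω * p j ω ∂P := by simp only [mul_comm]
  calc _ = (∫ ω, I i ω * I j ω ∂P - ∫ ω, I i ω * p j ω ∂P) -
        (∫ ω, I j ω * p i ω ∂P - ∫ ω, p i ω * p j ω ∂P) := by
        rw [← integral_sub i1 i2, ← integral_sub i3 i4]
        exact integral_sub (i1.sub i2) (i3.sub i4)
    _ = 0 := by rw [hII, hIp i j, hIp j i, hcomm, sub_self]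

/-- If the random masses of `s` converge almost surely, then the empirical frequencies of `s`
converge almost surely to the same limit. -/
theorem ae_tendsto_frequency [IsProbabilityMeasure P] (h : IsProductDisintegration P X ξ)
    {s : Set S} (hs : MeasurableSet s) {q : Ω → ℝ}
    (hq : ∀ᵐ ω ∂P, Tendsto (fun n => (ξ n ω s).toReal) atTop (nhds (q ω))) :
    ∀ᵐ ω ∂P, Tendsto (fun n : ℕ =>
      (∑ i ∈ Finset.range n, s.indicator (fun _ => (1 : ℝ)) (X i ω)) / n) atTop (nhds (q ω)) := by
  filter_upwards [hq, ae_tendsto_sum_div_sq_of_orthogonal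
    (fun i => (h.measurable_indicator hs i).sub (h.measurable_toReal hs i))
    (h.abs_indicator_sub_le_one s) fun i j hij => h.integral_centred_mul_centred hs hij]
    with ω hω hD
  refine tendsto_div_of_monotone_of_tendsto_sq
    (u := fun n => ∑ i ∈ Finset.range n, s.indicator (fun _ => (1 : ℝ)) (X i ω))
    (monotone_nat_of_le_succ fun n => ?_) ?_
  · rw [Finset.sum_range_succ]
    exact le_add_of_nonneg_right (Set.indicator_nonneg (fun _ _ => zero_le_one) _)
  · have hsq : Tendsto (fun k : ℕ => (k + 1) ^ 2) atTop atTop :=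
      (tendsto_pow_atTop two_ne_zero).comp (tendsto_add_atTop_nat 1)
    have hadd := hD.add (hω.cesaro.comp hsq)
    rw [zero_add] at hadd
    refine hadd.congr fun k => ?_
    simp only [Function.comp_apply, Pi.sub_apply, Finset.sum_sub_distrib]
    ring

end IsProductDisintegration

theorem statement14
    {Ω : Type*} [MeasurableSpace Ω] (P : Measure Ω) [IsProbabilityMeasure P]
    (ϑ : ℕ → Ω → ℝ) (hϑmeas : ∀ n, StronglyMeasurable (ϑ n))
    (hϑrange : ∀ n ω, ϑ n ω ∈ Set.Icc (0 : ℝ) 1)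
    (hsub : Submartingale ϑ (Filtration.natural ϑ hϑmeas) P)
    (ϑlim : Ω → ℝ) (hϑlimrange : ∀ ω, ϑlim ω ∈ Set.Icc (0 : ℝ) 1)
    (hconv : ∀ᵐ ω ∂P, Tendsto (fun n => ϑ n ω) atTop (nhds (ϑlim ω)))
    (X : ℕ → Ω → ({0, 1} : Set ℝ)) (ξ : ℕ → Ω → Measure ({0, 1} : Set ℝ))
    (hξ1 : ∀ n ω, ξ n ω {x | (x : ℝ) = 1} = ENNReal.ofReal (ϑ n ω))
    (hξ0 : ∀ n ω, ξ n ω {x | (x : ℝ) = 0} = ENNReal.ofReal (1 - ϑ n ω))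
    (hdis : IsProductDisintegration P X ξ) :
    ∀ᵐ ω ∂P,
      Tendsto (fun n : ℕ => (1 / (n : ℝ)) *
          ∑ i ∈ Finset.range n, if X i ω = (⟨1, Or.inr rfl⟩ : ({0, 1} : Set ℝ)) then (1 : ℝ) else 0)
        atTop (nhds (ϑlim ω)) := by
  have hs : MeasurableSet {x : ({0, 1} : Set ℝ) | (x : ℝ) = 1} :=
    measurable_subtype_coe (measurableSet_singleton 1)
  have hmass : ∀ n ω, (ξ n ω {x | (x : ℝ) = 1}).toReal = ϑ n ω := fun n ω => by
    rw [hξ1, ENNReal.toReal_ofReal (hϑrange n ω).1]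
  filter_upwards [hdis.ae_tendsto_frequency hs (q := ϑlim) (by simpa only [hmass] using hconv)]
    with ω hω
  refine hω.congr fun n => ?_
  rw [one_div_mul_eq_div]
  simp [Set.indicator_apply, Subtype.ext_iff]
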